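/- Let λ : ℕ≥1 → ℂ satisfy the normalized Hecke relations, with constants C > 0 and A ≥ 0 such that |λ(n)| ≤ C·n^A for all n ≥ 1, and let ν ∈ ℂ. Then for every s ∈ ℂ with Re s > 1 + A + max(0, Re ν) one has ∑_{n≥1} λ(n) σ_ν(n) n^{−s} = L(s)·L(s−ν)/ζ(2s−ν), where L(w) = ∑_{n≥1} λ(n) n^{−w} (absolutely convergent for Re w > 1 + A) and ζ is the Riemann zeta function; in this region ζ(2s−ν) ≠ 0 since Re(2s−ν) > 1. -/

import Mathlib

/-- The complex divisor sum `σ_ν(n) = ∑_{d ∣ n} d^ν`. -/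
noncomputable def csigma (ν : ℂ) (n : ℕ) : ℂ := ∑ d ∈ n.divisors, (d : ℂ) ^ ν

/-- The Dirichlet series `L(w) = ∑_{n ≥ 1} l n * n ^ (-w)` attached to `l`. -/
noncomputable def Lfun (l : ℕ → ℂ) (w : ℂ) : ℂ :=
  ∑' n : ℕ, if n = 0 then 0 else l n * (n : ℂ) ^ (-w)

open ArithmeticFunction LSeries Finset

/-- The arithmetic function `n ↦ n ^ ν`, with value `0` at `0`. -/
noncomputable def cpowArith (ν : ℂ) : ArithmeticFunction ℂ :=
  toArithmeticFunction fun n ↦ (n : ℂ) ^ ν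

/-- The arithmetic function supported on squares with `d ^ 2 ↦ d ^ ν`. -/
noncomputable def squareCpowArith (ν : ℂ) : ArithmeticFunction ℂ :=
  toArithmeticFunction fun n ↦ if IsSquare n then (n : ℂ) ^ (ν / 2) else 0

lemma toArithmeticFunction_apply_of_ne_zero {R : Type*} [Zero R] (f : ℕ → R) {n : ℕ}
    (hn : n ≠ 0) : toArithmeticFunction f n = f n := by
  simp [toArithmeticFunction, hn]

lemma cpowArith_apply (ν : ℂ) {n : ℕ} (hn : n ≠ 0) : cpowArith ν n = (n : ℂ) ^ ν :=
  toArithmeticFunction_apply_of_ne_zero _ hn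

lemma squareCpowArith_apply (ν : ℂ) {n : ℕ} (hn : n ≠ 0) :
    squareCpowArith ν n = if IsSquare n then (n : ℂ) ^ (ν / 2) else 0 :=
  toArithmeticFunction_apply_of_ne_zero _ hn

lemma isMultiplicative_toArithmeticFunction {R : Type*} [MonoidWithZero R] {f : ℕ → R}
    (h1 : f 1 = 1)
    (hmul : ∀ m n : ℕ, 1 ≤ m → 1 ≤ n → Nat.Coprime m n → f (m * n) = f m * f n) :
    (toArithmeticFunction f).IsMultiplicative := by
  refine IsMultiplicative.iff_ne_zero.2 ⟨?_, fun {m n} hm hn hmn ↦ ?_⟩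
  · rw [toArithmeticFunction_apply_of_ne_zero _ one_ne_zero, h1]
  · rw [toArithmeticFunction_apply_of_ne_zero _ (mul_ne_zero hm hn),
      toArithmeticFunction_apply_of_ne_zero _ hm, toArithmeticFunction_apply_of_ne_zero _ hn]
    exact hmul m n (Nat.one_le_iff_ne_zero.2 hm) (Nat.one_le_iff_ne_zero.2 hn) hmn

lemma isMultiplicative_cpowArith (ν : ℂ) : (cpowArith ν).IsMultiplicative :=
  isMultiplicative_toArithmeticFunction (by simp) fun m n _ _ _ ↦ by
    simp [Complex.natCast_mul_natCast_cpow]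

lemma Nat.Coprime.isSquare_mul_iff {m n : ℕ} (h : m.Coprime n) :
    IsSquare (m * n) ↔ IsSquare m ∧ IsSquare n := by
  refine ⟨fun ⟨r, hr⟩ ↦ ⟨?_, ?_⟩, fun ⟨hm, hn⟩ ↦ hm.mul hn⟩
  · obtain ⟨d, hd⟩ := exists_eq_pow_of_mul_eq_pow (Nat.isUnit_iff.2 h) (hr.trans (sq r).symm)
    exact ⟨d, hd.trans (sq d)⟩
  · obtain ⟨d, hd⟩ := exists_eq_pow_of_mul_eq_pow (Nat.isUnit_iff.2 h.symm)
      ((mul_comm n m).trans (hr.trans (sq r).symm))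
    exact ⟨d, hd.trans (sq d)⟩

lemma isMultiplicative_squareCpowArith (ν : ℂ) : (squareCpowArith ν).IsMultiplicative :=
  isMultiplicative_toArithmeticFunction (by simp) fun m n _ _ h ↦ by
    by_cases hm : IsSquare m <;> by_cases hn : IsSquare n <;>
      simp [h.isSquare_mul_iff, hm, hn, Complex.natCast_mul_natCast_cpow]

lemma csigma_eq_mul (ν : ℂ) (n : ℕ) : csigma ν n = (cpowArith ν * cpowArith 0) n := by
  rw [csigma, mul_apply, Nat.sum_divisorsAntidiagonal fun i j ↦ cpowArith ν i * cpowArith 0 j]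
  refine sum_congr rfl fun d hd ↦ ?_
  have hn := (Nat.mem_divisors.1 hd).2
  have hd' := (Nat.mem_divisors.1 hd).1
  rw [cpowArith_apply _ (ne_zero_of_dvd_ne_zero hn hd'),
    cpowArith_apply _ (Nat.div_ne_zero_iff_of_dvd hd' |>.2 ⟨hn, ne_zero_of_dvd_ne_zero hn hd'⟩)]
  simp

lemma csigma_prime_pow (ν : ℂ) {p : ℕ} (hp : p.Prime) (k : ℕ) :
    csigma ν (p ^ k) = ∑ j ∈ range (k + 1), ((p : ℂ) ^ ν) ^ j := by
  rw [csigma, Nat.sum_divisors_prime_pow hp]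
  refine sum_congr rfl fun j _ ↦ ?_
  rw [Nat.cast_pow, ← Complex.natCast_cpow_natCast_mul, mul_comm, Complex.cpow_mul_nat]

lemma ArithmeticFunction.mul_apply_prime_pow {R : Type*} [Semiring R]
    (f g : ArithmeticFunction R) {p : ℕ} (hp : p.Prime) (k : ℕ) :
    (f * g) (p ^ k) = ∑ j ∈ range (k + 1), f (p ^ j) * g (p ^ (k - j)) := by
  rw [mul_apply, Nat.sum_divisorsAntidiagonal fun i j ↦ f i * g j, Nat.sum_divisors_prime_pow hp]
  refine sum_congr rfl fun j hj ↦ ?_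
  rw [Nat.pow_div (Nat.lt_succ_iff.1 (mem_range.1 hj)) hp.pos]

/-- The Hecke recursion on the powers of one prime, in product form. -/
lemma hecke_mul_sub_mul {R : Type*} [CommRing R] {a : ℕ → R} (h0 : a 0 = 1)
    (hrec : ∀ k, a (k + 2) = a 1 * a (k + 1) - a k) (i j : ℕ) :
    a (i + 1) * a (j + 1) - a i * a j = a (i + j + 2) := by
  induction i generalizing j with
  | zero => rw [h0, zero_add, zero_add, hrec, one_mul]
  | succ i ih =>
    have := ih (j + 1)
    rw [show i + 1 + j + 2 = i + (j + 1) + 2 by ring, ← this, hrec i, hrec j]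
    ring

lemma sum_hecke_mul_pow_succ_succ {R : Type*} [CommRing R] {a : ℕ → R} (h0 : a 0 = 1)
    (hrec : ∀ k, a (k + 2) = a 1 * a (k + 1) - a k) (x : R) (k : ℕ) :
    ∑ j ∈ range (k + 3), a j * (a (k + 2 - j) * x ^ (k + 2 - j)) =
      a (k + 2) * ∑ j ∈ range (k + 3), x ^ j +
        x * ∑ j ∈ range (k + 1), a j * (a (k - j) * x ^ (k - j)) := by
  rw [← sum_range_reflect (fun j ↦ x ^ j), sum_range_succ, sum_range_succ',
    sum_range_succ (n := k + 2), sum_range_succ' (n := k + 1), mul_add, mul_add, mul_sum, mul_sum]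
  have key : ∀ j ∈ range (k + 1), a (j + 1) * (a (k + 2 - (j + 1)) * x ^ (k + 2 - (j + 1))) =
      a (k + 2) * x ^ (k + 3 - 1 - (j + 1)) + x * (a j * (a (k - j) * x ^ (k - j))) := by
    intro j hj
    obtain ⟨m, rfl⟩ := Nat.exists_eq_add_of_le (Nat.lt_succ_iff.1 (mem_range.1 hj))
    rw [show j + m + 2 - (j + 1) = m + 1 by omega, show j + m + 3 - 1 - (j + 1) = m + 1 by omega,
      show j + m - j = m by omega, ← hecke_mul_sub_mul h0 hrec j m]
    ring
  rw [sum_congr rfl key, sum_add_distrib]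
  simp [h0]
  ring

lemma squareCpowArith_prime (ν : ℂ) {p : ℕ} (hp : p.Prime) : squareCpowArith ν p = 0 := by
  rw [squareCpowArith_apply _ hp.ne_zero, if_neg hp.prime.not_isSquare]

lemma squareCpowArith_sq_mul (ν : ℂ) {m n : ℕ} (hm : m ≠ 0) :
    squareCpowArith ν (m ^ 2 * n) = (m : ℂ) ^ ν * squareCpowArith ν n := by
  rcases eq_or_ne n 0 with rfl | hn
  · simp
  have hsq : IsSquare (m ^ 2 * n) ↔ IsSquare n := by
    refine ⟨fun ⟨r, hr⟩ ↦ ?_, fun h ↦ (IsSquare.sq m).mul h⟩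
    obtain ⟨d, rfl⟩ : m ∣ r := (Nat.pow_dvd_pow_iff two_ne_zero).1 ⟨n, by rw [hr, sq]⟩
    exact ⟨d, Nat.eq_of_mul_eq_mul_left (pow_pos (Nat.pos_of_ne_zero hm) 2) (by rw [hr]; ring)⟩
  rw [squareCpowArith_apply _ (mul_ne_zero (pow_ne_zero 2 hm) hn), squareCpowArith_apply _ hn]
  simp only [hsq]
  split_ifs
  · rw [Nat.cast_mul, Complex.natCast_mul_natCast_cpow, Nat.cast_pow,
      ← Complex.natCast_cpow_natCast_mul]
    congr 2
    push_cast
    ring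
  · simp

/-- For `l` with the normalized Hecke relations, the divisor-twisted function `l * σ_ν` convolved
with `d ^ 2 ↦ d ^ ν` is the convolution of `l` with `n ↦ l n * n ^ ν`. -/
lemma squareCpowArith_mul_hecke {l : ℕ → ℂ} (h1 : l 1 = 1)
    (hmul : ∀ m n : ℕ, 1 ≤ m → 1 ≤ n → Nat.Coprime m n → l (m * n) = l m * l n)
    (hrec : ∀ p : ℕ, p.Prime → ∀ k : ℕ, 1 ≤ k →
      l (p ^ (k + 1)) = l p * l (p ^ k) - l (p ^ (k - 1))) (ν : ℂ) :
    squareCpowArith ν * (toArithmeticFunction l).pmul (cpowArith ν * cpowArith 0) =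
      toArithmeticFunction l * (toArithmeticFunction l).pmul (cpowArith ν) := by
  have hl := isMultiplicative_toArithmeticFunction h1 hmul
  have hν := isMultiplicative_cpowArith ν
  refine (IsMultiplicative.eq_iff_eq_on_prime_powers _ ((isMultiplicative_squareCpowArith ν).mul
    (hl.pmul (hν.mul (isMultiplicative_cpowArith 0)))) _ (hl.mul (hl.pmul hν))).2 fun p k hp ↦ ?_
  have hpk (j : ℕ) : p ^ j ≠ 0 := pow_ne_zero j hp.ne_zero
  have h0 : l (p ^ 0) = 1 := by rw [pow_zero, h1]
  have hrec' (k : ℕ) : l (p ^ (k + 2)) = l (p ^ 1) * l (p ^ (k + 1)) - l (p ^ k) := by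
    simpa using hrec p hp (k + 1) (by omega)
  have hpow (j : ℕ) : ((p ^ j : ℕ) : ℂ) ^ ν = ((p : ℂ) ^ ν) ^ j := by
    rw [Nat.cast_pow, ← Complex.natCast_cpow_natCast_mul, mul_comm, Complex.cpow_mul_nat]
  rw [mul_apply_prime_pow _ _ hp, mul_apply_prime_pow _ _ hp]
  simp only [pmul_apply, ← csigma_eq_mul, csigma_prime_pow ν hp, cpowArith_apply ν (hpk _),
    toArithmeticFunction_apply_of_ne_zero l (hpk _), hpow]
  have hsq1 : squareCpowArith ν 1 = 1 := (isMultiplicative_squareCpowArith ν).map_one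
  induction k using Nat.twoStepInduction with
  | zero => simp [hsq1, h1]
  | one => simp [sum_range_succ, hsq1, squareCpowArith_prime ν hp, h1]; ring
  | more k ih _ =>
    rw [sum_hecke_mul_pow_succ_succ (a := fun j ↦ l (p ^ j)) h0 hrec' ((p : ℂ) ^ ν) k, ← ih,
      sum_range_succ', sum_range_succ']
    have hstep (j : ℕ) : squareCpowArith ν (p ^ (j + 1 + 1)) =
        (p : ℂ) ^ ν * squareCpowArith ν (p ^ j) := by
      rw [← squareCpowArith_sq_mul ν hp.ne_zero]
      congr 1
      ring
    simp only [hstep, Nat.add_sub_add_right, zero_add, pow_one, pow_zero, hsq1,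
      squareCpowArith_prime ν hp]
    simp only [mul_assoc, ← mul_sum, zero_mul, add_zero, one_mul, Nat.sub_zero]
    rw [add_comm]

lemma LSeriesSummable_of_norm_le {f g : ℕ → ℂ} {s : ℂ} (hg : LSeriesSummable g s)
    (h : ∀ n ≠ 0, ‖f n‖ ≤ ‖g n‖) : LSeriesSummable f s :=
  Summable.of_norm_bounded (Summable.norm hg) fun n ↦ by
    rcases eq_or_ne n 0 with rfl | hn
    · simp
    · exact norm_term_le s (h n hn)

lemma LSeriesSummable_cpowArith {ν s : ℂ} (h : 1 + ν.re < s.re) :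
    LSeriesSummable (cpowArith ν) s :=
  LSeriesSummable_of_le_const_mul_rpow h ⟨1, fun n hn ↦ by
    rw [cpowArith_apply ν hn, Complex.norm_natCast_cpow_of_pos (Nat.pos_of_ne_zero hn)]
    simp⟩

lemma cpowArith_pmul_mul (w ν μ : ℂ) :
    (cpowArith w).pmul (cpowArith ν * cpowArith μ) = cpowArith (w + ν) * cpowArith (w + μ) := by
  ext n
  rw [pmul_apply, mul_apply, mul_apply, mul_sum]
  refine sum_congr rfl fun x hx ↦ ?_
  obtain ⟨hx, hn⟩ := Nat.mem_divisorsAntidiagonal.1 hx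
  subst hx
  obtain ⟨h1, h2⟩ := mul_ne_zero_iff.1 hn
  rw [cpowArith_apply _ hn, cpowArith_apply _ h1, cpowArith_apply _ h2, cpowArith_apply _ h1,
    cpowArith_apply _ h2, Complex.cpow_add _ _ (Nat.cast_ne_zero.2 h1),
    Complex.cpow_add _ _ (Nat.cast_ne_zero.2 h2), Nat.cast_mul, Complex.natCast_mul_natCast_cpow]
  ring

lemma norm_csigma_le (ν : ℂ) (n : ℕ) : ‖csigma ν n‖ ≤ ‖csigma (ν.re : ℂ) n‖ := by
  have h : csigma (ν.re : ℂ) n = ((∑ d ∈ n.divisors, (d : ℝ) ^ ν.re : ℝ) : ℂ) := by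
    rw [csigma, Complex.ofReal_sum]
    refine sum_congr rfl fun d _ ↦ ?_
    rw [Complex.ofReal_cpow d.cast_nonneg, Complex.ofReal_natCast]
  rw [h, Complex.norm_of_nonneg (sum_nonneg fun d _ ↦ by positivity), csigma]
  refine (norm_sum_le _ _).trans (sum_le_sum fun d hd ↦ ?_)
  rw [Complex.norm_natCast_cpow_of_pos (Nat.pos_of_mem_divisors hd)]

lemma LSeriesSummable_mul_csigma {l : ℕ → ℂ} {C A : ℝ}
    (hbd : ∀ n : ℕ, 1 ≤ n → ‖l n‖ ≤ C * (n : ℝ) ^ A) {ν s : ℂ}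
    (hs : 1 + A + max 0 ν.re < s.re) :
    LSeriesSummable (fun n ↦ l n * csigma ν n) s := by
  have hsum : LSeriesSummable
      ((C : ℂ) • ⇑((cpowArith (A : ℂ)).pmul (cpowArith (ν.re : ℂ) * cpowArith 0))) s := by
    rw [cpowArith_pmul_mul]
    refine (LSeriesSummable_mul (LSeriesSummable_cpowArith ?_)
      (LSeriesSummable_cpowArith ?_)).smul _
    · simp only [Complex.add_re, Complex.ofReal_re]
      linarith [le_max_right 0 ν.re]
    · simp only [Complex.add_re, Complex.ofReal_re, Complex.zero_re]
      linarith [le_max_left 0 ν.re]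
  refine LSeriesSummable_of_norm_le hsum fun n hn ↦ ?_
  have hn' := Nat.pos_of_ne_zero hn
  rw [Pi.smul_apply, pmul_apply, ← csigma_eq_mul, cpowArith_apply _ hn, norm_mul, norm_smul,
    norm_mul, Complex.norm_natCast_cpow_of_pos hn', Complex.ofReal_re, ← mul_assoc,
    Complex.norm_real]
  have hC : C * (n : ℝ) ^ A ≤ ‖C‖ * (n : ℝ) ^ A := by
    gcongr
    exact Real.le_norm_self C
  exact mul_le_mul ((hbd n hn').trans hC) (norm_csigma_le ν n) (norm_nonneg _) (by positivity)

lemma LSeriesHasSum_squareCpowArith {ν s : ℂ} (h : 1 < (2 * s - ν).re) :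
    LSeriesHasSum (squareCpowArith ν) s (riemannZeta (2 * s - ν)) := by
  have hinj : Function.Injective fun n : ℕ ↦ n ^ 2 := Nat.pow_left_injective two_ne_zero
  have hterm : term (squareCpowArith ν) s ∘ (fun n : ℕ ↦ n ^ 2) =
      fun n : ℕ ↦ 1 / (n : ℂ) ^ (2 * s - ν) := by
    funext n
    have hne : 2 * s - ν ≠ 0 := fun h0 ↦ by norm_num [h0] at h
    rcases eq_or_ne n 0 with rfl | hn
    · simp [hne]
    · have hn' : (n : ℂ) ≠ 0 := Nat.cast_ne_zero.2 hn
      have h1 : squareCpowArith ν (n ^ 2) = (n : ℂ) ^ ν := by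
        simpa [(isMultiplicative_squareCpowArith ν).map_one] using
          squareCpowArith_sq_mul ν (n := 1) hn
      have h2 : ((n : ℂ) ^ 2) ^ s = (n : ℂ) ^ (2 * s) := by
        simpa using (Complex.natCast_cpow_natCast_mul n 2 s).symm
      rw [Function.comp_apply, term_of_ne_zero (pow_ne_zero 2 hn), h1, Nat.cast_pow, h2,
        Complex.cpow_sub _ _ hn', one_div_div]
  rw [LSeriesHasSum, ← hinj.hasSum_iff, hterm, zeta_eq_tsum_one_div_nat_cpow h]
  · exact (Complex.summable_one_div_nat_cpow.2 h).hasSum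
  · intro n hn
    rcases eq_or_ne n 0 with rfl | hn0
    · simp
    · have : ¬ IsSquare n := fun ⟨r, hr⟩ ↦ hn ⟨r, (sq r).trans hr.symm⟩
      rw [term_of_ne_zero hn0, squareCpowArith_apply _ hn0, if_neg this, zero_div]

lemma Lfun_eq_LSeries (l : ℕ → ℂ) (w : ℂ) : Lfun l w = LSeries l w := by
  simp only [Lfun, LSeries, term_def, Complex.cpow_neg, div_eq_mul_inv]

lemma term_toArithmeticFunction (l : ℕ → ℂ) (s : ℂ) :
    term (toArithmeticFunction l) s = term l s := by
  funext n
  rcases eq_or_ne n 0 with rfl | hn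
  · simp
  · rw [term_of_ne_zero hn, term_of_ne_zero hn, toArithmeticFunction_apply_of_ne_zero l hn]

lemma term_toArithmeticFunction_pmul_cpowArith (l : ℕ → ℂ) (ν s : ℂ) :
    term ((toArithmeticFunction l).pmul (cpowArith ν)) s = term l (s - ν) := by
  funext n
  rcases eq_or_ne n 0 with rfl | hn
  · simp
  · rw [term_of_ne_zero hn, term_of_ne_zero hn, pmul_apply, cpowArith_apply ν hn,
      toArithmeticFunction_apply_of_ne_zero l hn, Complex.cpow_sub _ _ (Nat.cast_ne_zero.2 hn),
      div_div_eq_mul_div]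

lemma term_toArithmeticFunction_pmul_csigma (l : ℕ → ℂ) (ν s : ℂ) :
    term ((toArithmeticFunction l).pmul (cpowArith ν * cpowArith 0)) s =
      term (fun n ↦ l n * csigma ν n) s := by
  funext n
  rcases eq_or_ne n 0 with rfl | hn
  · simp
  · rw [term_of_ne_zero hn, term_of_ne_zero hn, pmul_apply, csigma_eq_mul,
      toArithmeticFunction_apply_of_ne_zero l hn]

/-- Rankin–Selberg type identity: if `l` satisfies the normalized Hecke relations with
polynomial bound `‖l n‖ ≤ C * n ^ A`, then for `Re s > 1 + A + max 0 (Re ν)` one has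
`∑_{n ≥ 1} l n * σ_ν n * n^(-s) = L(s) L(s - ν) / ζ(2s - ν)`. -/
theorem hecke_divisor_dirichlet_series (l : ℕ → ℂ) (C A : ℝ)
    (hC : 0 < C) (hA : 0 ≤ A)
    (h1 : l 1 = 1)
    (hmul : ∀ m n : ℕ, 1 ≤ m → 1 ≤ n → Nat.Coprime m n → l (m * n) = l m * l n)
    (hrec : ∀ p : ℕ, p.Prime → ∀ k : ℕ, 1 ≤ k →
      l (p ^ (k + 1)) = l p * l (p ^ k) - l (p ^ (k - 1)))
    (hbd : ∀ n : ℕ, 1 ≤ n → ‖l n‖ ≤ C * (n : ℝ) ^ A)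
    (ν : ℂ) (s : ℂ) (hs : 1 + A + max 0 ν.re < s.re) :
    (∑' n : ℕ, if n = 0 then 0 else l n * csigma ν n * (n : ℂ) ^ (-s)) =
      Lfun l s * Lfun l (s - ν) / riemannZeta (2 * s - ν) := by
  have hz : 1 < (2 * s - ν).re := by
    simp only [Complex.sub_re, Complex.mul_re, Complex.re_ofNat, Complex.im_ofNat]
    linarith [le_max_left 0 ν.re, le_max_right 0 ν.re]
  have hsum {w : ℂ} (hw : 1 + A < w.re) : LSeriesSummable l w :=
    LSeriesSummable_of_le_const_mul_rpow hw ⟨C, fun n hn ↦ by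
      simpa using hbd n (Nat.one_le_iff_ne_zero.2 hn)⟩
  have hF : LSeriesHasSum (toArithmeticFunction l) s (Lfun l s) := by
    rw [LSeriesHasSum, term_toArithmeticFunction, Lfun_eq_LSeries]
    exact (hsum (by linarith [le_max_left 0 ν.re])).LSeriesHasSum
  have hG : LSeriesHasSum ((toArithmeticFunction l).pmul (cpowArith ν)) s (Lfun l (s - ν)) := by
    rw [LSeriesHasSum, term_toArithmeticFunction_pmul_cpowArith, Lfun_eq_LSeries]
    refine (hsum ?_).LSeriesHasSum
    rw [Complex.sub_re]
    linarith [le_max_right 0 ν.re]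
  have hH : LSeriesHasSum ((toArithmeticFunction l).pmul (cpowArith ν * cpowArith 0)) s
      (Lfun (fun n ↦ l n * csigma ν n) s) := by
    rw [LSeriesHasSum, term_toArithmeticFunction_pmul_csigma, Lfun_eq_LSeries]
    exact (LSeriesSummable_mul_csigma hbd hs).LSeriesHasSum
  have hprod := LSeriesHasSum_mul (LSeriesHasSum_squareCpowArith hz) hH
  rw [squareCpowArith_mul_hecke h1 hmul hrec ν] at hprod
  rw [eq_div_iff (riemannZeta_ne_zero_of_one_lt_re hz), mul_comm]
  exact hprod.unique (LSeriesHasSum_mul hF hG)
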